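/- Fix a real parameter γ ≥ 7/5 and define for θ ∈ [0,2π) the trigonometric polynomials a(θ) = (γ⁴ + 2γ³ − γ² + γ/3 − 1/20) + (−4γ⁴ − 4γ³ + 7γ² − 2γ + 17/60)e^{iθ} + (6γ⁴ − 9γ² + 6γ − 43/60)e^{2iθ} + (−4γ⁴ + 4γ³ + γ² − 10γ/3 + 77/60)e^{3iθ} + (γ⁴ − 2γ³ + 2γ² − γ + 1/5)e^{4iθ}, b(θ) = (γ + (1 − γ)e^{iθ})⁴, and c(θ) = e^{−iθ}·[(γ + (1 − γ)e^{iθ})⁴ − γ⁴(1 − e^{iθ})⁵] (which is a polynomial of degree 4 in e^{iθ}); these are the semi-generating functions of the SIEMS5 scheme. Then a(θ) ≠ 0 for all θ, and: max_{θ∈[0,2π)} |1/a(θ)| = 1, max_{θ∈[0,2π)} |c(θ)/a(θ)| = 15(16γ⁴ + 32γ³ − 24γ² + 8γ − 1)/(16(15γ⁴ − 15γ² + 10γ − 2)), and min_{θ∈[0,2π)} Re(b(θ)/a(θ)) = 15(2γ − 1)⁴/(16(15γ⁴ − 15γ² + 10γ − 2)). Consequently the implicit–explicit controllability intensity of the SIEMS5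 scheme equals (2γ − 1)⁴/(16γ⁴ + 32γ³ − 24γ² + 8γ − 1). -/

import Mathlib

open Real Set

/-- The real part of `∑ pⱼ e^{ijθ}` (degree four) as a polynomial in `x = cos θ`. -/
def quarticRe (p₀ p₁ p₂ p₃ p₄ x : ℝ) : ℝ :=
  p₀ + p₁ * x + p₂ * (2*x^2 - 1) + p₃ * (4*x^3 - 3*x) + p₄ * (8*x^4 - 8*x^2 + 1)

/-- The imaginary part of `∑ pⱼ e^{ijθ}` (degree four), divided by `sin θ`, as a polynomial in
`x = cos θ`. -/
def quarticIm (p₁ p₂ p₃ p₄ x : ℝ) : ℝ :=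
  p₁ + p₂ * (2*x) + p₃ * (4*x^2 - 1) + p₄ * (8*x^3 - 4*x)

lemma quartic_eq (p₀ p₁ p₂ p₃ p₄ x y : ℝ) (h : y^2 = 1 - x^2) :
    (p₀ : ℂ) + p₁ * (x + y * Complex.I) + p₂ * (x + y * Complex.I)^2
      + p₃ * (x + y * Complex.I)^3 + p₄ * (x + y * Complex.I)^4 =
    ⟨quarticRe p₀ p₁ p₂ p₃ p₄ x, y * quarticIm p₁ p₂ p₃ p₄ x⟩ := by
  have h2 : ((x : ℂ) + y * Complex.I)^2 = (2*x^2 - 1 : ℝ) + (y * (2*x) : ℝ) * Complex.I := by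
    apply Complex.ext <;> simp only [pow_two,
      Complex.mul_re, Complex.add_re, Complex.add_im, Complex.ofReal_re,
      Complex.ofReal_im, Complex.mul_im, Complex.I_re, Complex.I_im]
    · linear_combination -h
    · ring
  have h3 : ((x : ℂ) + y * Complex.I)^3 =
      (4*x^3 - 3*x : ℝ) + (y * (4*x^2 - 1) : ℝ) * Complex.I := by
    rw [pow_succ, h2]
    apply Complex.ext
    · simp only [Complex.mul_re, Complex.add_re, Complex.add_im, Complex.ofReal_re,
        Complex.ofReal_im, Complex.mul_im, Complex.I_re, Complex.I_im]
      linear_combination (-2*x) * h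
    · simp only [Complex.mul_re, Complex.add_re, Complex.add_im, Complex.ofReal_re,
        Complex.ofReal_im, Complex.mul_im, Complex.I_re, Complex.I_im]
      ring
  have h4 : ((x : ℂ) + y * Complex.I)^4 =
      (8*x^4 - 8*x^2 + 1 : ℝ) + (y * (8*x^3 - 4*x) : ℝ) * Complex.I := by
    rw [pow_succ, h3]
    apply Complex.ext
    · simp only [Complex.mul_re, Complex.add_re, Complex.add_im, Complex.ofReal_re,
        Complex.ofReal_im, Complex.mul_im, Complex.I_re, Complex.I_im]
      linear_combination (-4*x^2 + 1) * h
    · simp only [Complex.mul_re, Complex.add_re, Complex.add_im, Complex.ofReal_re,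
        Complex.ofReal_im, Complex.mul_im, Complex.I_re, Complex.I_im]
      ring
  rw [h2, h3, h4]
  apply Complex.ext
  · simp only [Complex.mul_re, Complex.add_re, Complex.add_im, Complex.ofReal_re,
      Complex.ofReal_im, Complex.mul_im, Complex.I_re, Complex.I_im, quarticRe]
    ring
  · simp only [Complex.mul_re, Complex.add_re, Complex.add_im, Complex.ofReal_re,
      Complex.ofReal_im, Complex.mul_im, Complex.I_re, Complex.I_im, quarticIm]
    ring

/-- The real part of `a(θ)` as a polynomial in `x = cos θ`. -/
noncomputable def siemsARe (γ x : ℝ) : ℝ :=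
  quarticRe (γ^4 + 2*γ^3 - γ^2 + γ/3 - 1/20) (-4*γ^4 - 4*γ^3 + 7*γ^2 - 2*γ + 17/60)
    (6*γ^4 - 9*γ^2 + 6*γ - 43/60) (-4*γ^4 + 4*γ^3 + γ^2 - 10*γ/3 + 77/60)
    (γ^4 - 2*γ^3 + 2*γ^2 - γ + 1/5) x

/-- The imaginary part of `a(θ)` divided by `sin θ`, as a polynomial in `x = cos θ`. -/
noncomputable def siemsAIm (γ x : ℝ) : ℝ :=
  quarticIm (-4*γ^4 - 4*γ^3 + 7*γ^2 - 2*γ + 17/60)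
    (6*γ^4 - 9*γ^2 + 6*γ - 43/60) (-4*γ^4 + 4*γ^3 + γ^2 - 10*γ/3 + 77/60)
    (γ^4 - 2*γ^3 + 2*γ^2 - γ + 1/5) x

/-- The real part of `b(θ)` as a polynomial in `x = cos θ`. -/
def siemsBRe (γ x : ℝ) : ℝ :=
  quarticRe (γ^4) (4*γ^3*(1 - γ)) (6*γ^2*(1 - γ)^2) (4*γ*(1 - γ)^3) ((1 - γ)^4) x

/-- The imaginary part of `b(θ)` divided by `sin θ`, as a polynomial in `x = cos θ`. -/
def siemsBIm (γ x : ℝ) : ℝ :=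
  quarticIm (4*γ^3*(1 - γ)) (6*γ^2*(1 - γ)^2) (4*γ*(1 - γ)^3) ((1 - γ)^4) x

/-- The real part of `c(θ)` as a polynomial in `x = cos θ`. -/
def siemsCRe (γ x : ℝ) : ℝ :=
  quarticRe (γ^4 + 4*γ^3) (-4*γ^4 - 12*γ^3 + 6*γ^2) (6*γ^4 + 12*γ^3 - 12*γ^2 + 4*γ)
    (-4*γ^4 - 4*γ^3 + 6*γ^2 - 4*γ + 1) (γ^4) x

/-- The imaginary part of `c(θ)` divided by `sin θ`, as a polynomial in `x = cos θ`. -/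
def siemsCIm (γ x : ℝ) : ℝ :=
  quarticIm (-4*γ^4 - 12*γ^3 + 6*γ^2) (6*γ^4 + 12*γ^3 - 12*γ^2 + 4*γ)
    (-4*γ^4 - 4*γ^3 + 6*γ^2 - 4*γ + 1) (γ^4) x

/-- `|a(θ)|²` as a polynomial in `x = cos θ`. -/
noncomputable def siemsANormSq (γ x : ℝ) : ℝ :=
  siemsARe γ x ^ 2 + (1 - x^2) * siemsAIm γ x ^ 2

/-- `|c(θ)|²` as a polynomial in `x = cos θ`. -/
def siemsCNormSq (γ x : ℝ) : ℝ :=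
  siemsCRe γ x ^ 2 + (1 - x^2) * siemsCIm γ x ^ 2

/-- The real part of `b(θ)` times the conjugate of `a(θ)`, as a polynomial in `x = cos θ`. -/
noncomputable def siemsBCross (γ x : ℝ) : ℝ :=
  siemsBRe γ x * siemsARe γ x + (1 - x^2) * (siemsBIm γ x * siemsAIm γ x)

section Bounds

variable {γ x : ℝ}

/-- The difference is `1 - x` times a cubic which is a square plus a combination of Bernstein
polynomials on `[-1, 1]` whose coefficients have nonnegative expansions in `γ - 7/5`. -/
lemma one_le_siemsANormSq (hγ : 7/5 ≤ γ) (hx : -1 ≤ x) (hx' : x ≤ 1) :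
    1 ≤ siemsANormSq γ x := by
  have hu : 0 ≤ 1 - x := by linarith
  have hv : 0 ≤ 1 + x := by linarith
  have key : 3600 * (siemsANormSq γ x - 1) = (1 - x) *
      ((1 - x) * ((320*γ - 168) * (1 - x) - (212*γ - 190) * (1 + x))^2 +
        (57600*γ^8 - 115200*γ^6 + 76800*γ^5 + 42240*γ^4 - 76800*γ^3 + 40960*γ^2
         - 10240*γ + 799
          - (320*γ - 168)^2) * (1 - x)^3 +
        (57600*γ^6 - 230400*γ^5 + 324000*γ^4 - 244800*γ^3 + 107440*γ^2 - 25360*γ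
         + 1565 +
          2 * (320*γ - 168) * (212*γ - 190)) * ((1 - x)^2 * (1 + x)) +
        (21600*γ^4 - 43200*γ^3 + 33600*γ^2 - 12000*γ + 265
          - (212*γ - 190)^2) * ((1 - x) * (1 + x)^2) +
        (3600*γ^2 - 3600*γ + 75) * (1 + x)^3) := by
    simp only [siemsANormSq, siemsARe, siemsAIm, quarticRe, quarticIm]
    ring
  have h0 :
      0 ≤ 57600*γ^8 - 115200*γ^6 + 76800*γ^5 + 42240*γ^4 - 76800*γ^3 + 40960*γ^2
        - 10240*γ + 799 - (320*γ - 168)^2 := by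
    obtain ⟨g, hg, rfl⟩ := le_iff_exists_nonneg_add.1 hγ
    ring_nf
    positivity
  have h1 :
      0 ≤ 57600*γ^6 - 230400*γ^5 + 324000*γ^4 - 244800*γ^3 + 107440*γ^2 - 25360*γ
        + 1565 + 2 * (320*γ - 168) * (212*γ - 190) := by
    obtain ⟨g, hg, rfl⟩ := le_iff_exists_nonneg_add.1 hγ
    ring_nf
    positivity
  have h2 :
      0 ≤ 21600*γ^4 - 43200*γ^3 + 33600*γ^2 - 12000*γ + 265 - (212*γ - 190)^2 := by
    obtain ⟨g, hg, rfl⟩ := le_iff_exists_nonneg_add.1 hγ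
    ring_nf
    positivity
  have h3 :
      0 ≤ 3600*γ^2 - 3600*γ + 75 := by
    obtain ⟨g, hg, rfl⟩ := le_iff_exists_nonneg_add.1 hγ
    ring_nf
    positivity
  have : 0 ≤ 3600 * (siemsANormSq γ x - 1) := by
    rw [key]
    positivity
  linarith

/-- The difference is `1 + x` times a cubic whose Bernstein coefficients on `[-1, 1]` have
nonnegative expansions in `γ - 7/5`. -/
lemma siemsCNormSq_mul_le (hγ : 7/5 ≤ γ) (hx : -1 ≤ x) (hx' : x ≤ 1) :
    (16/15 * (15*γ^4 - 15*γ^2 + 10*γ - 2))^2 * siemsCNormSq γ x ≤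
      (16*γ^4 + 32*γ^3 - 24*γ^2 + 8*γ - 1)^2 * siemsANormSq γ x := by
  have hu : 0 ≤ 1 - x := by linarith
  have hv : 0 ≤ 1 + x := by linarith
  have key : 3600 * ((16*γ^4 + 32*γ^3 - 24*γ^2 + 8*γ - 1)^2 * siemsANormSq γ x -
      (16/15 * (15*γ^4 - 15*γ^2 + 10*γ - 2))^2 * siemsCNormSq γ x) = (1 + x) * (
        (73728000*γ^13 - 175104000*γ^12 + 6144000*γ^11 + 421888000*γ^10
           - 728678400*γ^9 + 686444800*γ^8 - 425282560*γ^7 + 180553216*γ^6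
           - 51426560*γ^5 + 8819392*γ^4 - 522240*γ^3 - 111840*γ^2 + 25312*γ
           - 1631)
          * (1 - x)^3 +
        (22118400*γ^11 - 27340800*γ^10 - 34099200*γ^9 + 101766400*γ^8
           - 100828160*γ^7 + 52645120*γ^6 - 13502720*γ^5 - 345024*γ^4
           + 1449728*γ^3 - 478256*γ^2 + 72752*γ - 4529)
          * ((1 - x)^2 * (1 + x)) +
        (3686400*γ^9 - 902400*γ^8 - 7603200*γ^7 + 9672960*γ^6 - 5064960*γ^5
           + 992480*γ^4 + 228800*γ^3 - 173664*γ^2 + 38144*γ - 3121)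
          * ((1 - x) * (1 + x)^2) +
        (230400*γ^7 + 172800*γ^6 - 364800*γ^5 + 195360*γ^4 - 24000*γ^3
           - 15760*γ^2 + 6640*γ - 799)
          * (1 + x)^3) := by
    simp only [siemsANormSq, siemsCNormSq, siemsARe, siemsAIm, siemsCRe, siemsCIm, quarticRe,
      quarticIm]
    ring
  have h0 :
      0 ≤ 73728000*γ^13 - 175104000*γ^12 + 6144000*γ^11 + 421888000*γ^10
        - 728678400*γ^9 + 686444800*γ^8 - 425282560*γ^7 + 180553216*γ^6
        - 51426560*γ^5 + 8819392*γ^4 - 522240*γ^3 - 111840*γ^2 + 25312*γ - 1631 := by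
    obtain ⟨g, hg, rfl⟩ := le_iff_exists_nonneg_add.1 hγ
    ring_nf
    positivity
  have h1 :
      0 ≤ 22118400*γ^11 - 27340800*γ^10 - 34099200*γ^9 + 101766400*γ^8
        - 100828160*γ^7 + 52645120*γ^6 - 13502720*γ^5 - 345024*γ^4 + 1449728*γ^3
        - 478256*γ^2 + 72752*γ - 4529 := by
    obtain ⟨g, hg, rfl⟩ := le_iff_exists_nonneg_add.1 hγ
    ring_nf
    positivity
  have h2 :
      0 ≤ 3686400*γ^9 - 902400*γ^8 - 7603200*γ^7 + 9672960*γ^6 - 5064960*γ^5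
        + 992480*γ^4 + 228800*γ^3 - 173664*γ^2 + 38144*γ - 3121 := by
    obtain ⟨g, hg, rfl⟩ := le_iff_exists_nonneg_add.1 hγ
    ring_nf
    positivity
  have h3 :
      0 ≤ 230400*γ^7 + 172800*γ^6 - 364800*γ^5 + 195360*γ^4 - 24000*γ^3
        - 15760*γ^2 + 6640*γ - 799 := by
    obtain ⟨g, hg, rfl⟩ := le_iff_exists_nonneg_add.1 hγ
    ring_nf
    positivity
  have : 0 ≤ 3600 * ((16*γ^4 + 32*γ^3 - 24*γ^2 + 8*γ - 1)^2 * siemsANormSq γ x -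
      (16/15 * (15*γ^4 - 15*γ^2 + 10*γ - 2))^2 * siemsCNormSq γ x) := by
    rw [key]
    positivity
  linarith

/-- The difference is `1 + x` times a cubic whose Bernstein coefficients on `[-1, 1]` have
nonnegative expansions in `γ - 7/5`. -/
lemma siemsANormSq_mul_le (hγ : 7/5 ≤ γ) (hx : -1 ≤ x) (hx' : x ≤ 1) :
    (2*γ - 1)^4 * siemsANormSq γ x ≤
      16/15 * (15*γ^4 - 15*γ^2 + 10*γ - 2) * siemsBCross γ x := by
  have hu : 0 ≤ 1 - x := by linarith
  have hv : 0 ≤ 1 + x := by linarith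
  have key : 3600 * (16/15 * (15*γ^4 - 15*γ^2 + 10*γ - 2) * siemsBCross γ x -
      (2*γ - 1)^4 * siemsANormSq γ x) = (1 + x) * (
        (2304000*γ^9 - 10656000*γ^8 + 21273600*γ^7 - 24601600*γ^6
           + 18374400*γ^5 - 9249600*γ^4 + 3149920*γ^3 - 701496*γ^2 + 92856*γ
           - 5569)
          * (1 - x)^3 +
        (691200*γ^7 - 2284800*γ^6 + 3244800*γ^5 - 2572000*γ^4 + 1230240*γ^3
           - 354840*γ^2 + 57080*γ - 3951)
          * ((1 - x)^2 * (1 + x)) +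
        (115200*γ^5 - 261600*γ^4 + 242400*γ^3 - 115080*γ^2 + 27880*γ - 2735)
          * ((1 - x) * (1 + x)^2) +
        (7200*γ^3 - 9000*γ^2 + 4200*γ - 705) * (1 + x)^3) := by
    simp only [siemsANormSq, siemsBCross, siemsARe, siemsAIm, siemsBRe, siemsBIm, quarticRe,
      quarticIm]
    ring
  have h0 :
      0 ≤ 2304000*γ^9 - 10656000*γ^8 + 21273600*γ^7 - 24601600*γ^6 + 18374400*γ^5
        - 9249600*γ^4 + 3149920*γ^3 - 701496*γ^2 + 92856*γ - 5569 := by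
    obtain ⟨g, hg, rfl⟩ := le_iff_exists_nonneg_add.1 hγ
    ring_nf
    positivity
  have h1 :
      0 ≤ 691200*γ^7 - 2284800*γ^6 + 3244800*γ^5 - 2572000*γ^4 + 1230240*γ^3
        - 354840*γ^2 + 57080*γ - 3951 := by
    obtain ⟨g, hg, rfl⟩ := le_iff_exists_nonneg_add.1 hγ
    ring_nf
    positivity
  have h2 :
      0 ≤ 115200*γ^5 - 261600*γ^4 + 242400*γ^3 - 115080*γ^2 + 27880*γ - 2735 := by
    obtain ⟨g, hg, rfl⟩ := le_iff_exists_nonneg_add.1 hγ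
    ring_nf
    positivity
  have h3 :
      0 ≤ 7200*γ^3 - 9000*γ^2 + 4200*γ - 705 := by
    obtain ⟨g, hg, rfl⟩ := le_iff_exists_nonneg_add.1 hγ
    ring_nf
    positivity
  have : 0 ≤ 3600 * (16/15 * (15*γ^4 - 15*γ^2 + 10*γ - 2) * siemsBCross γ x -
      (2*γ - 1)^4 * siemsANormSq γ x) := by
    rw [key]
    positivity
  linarith

end Bounds

/-- factors and implicit–explicit controllability intensity of
the γ-parameterized SIEMS5 scheme, for γ ≥ 7/5. -/
theorem stmt19 (γ : ℝ) (hγ : 7/5 ≤ γ) (a b c : ℝ → ℂ)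
    (ha : ∀ θ : ℝ, a θ = ((γ:ℂ)^4 + 2*(γ:ℂ)^3 - (γ:ℂ)^2 + (γ:ℂ)/3 - 1/20)
        + (-4*(γ:ℂ)^4 - 4*(γ:ℂ)^3 + 7*(γ:ℂ)^2 - 2*(γ:ℂ) + 17/60)
            * Complex.exp (Complex.I * θ)
        + (6*(γ:ℂ)^4 - 9*(γ:ℂ)^2 + 6*(γ:ℂ) - 43/60)
            * Complex.exp (2 * Complex.I * θ)
        + (-4*(γ:ℂ)^4 + 4*(γ:ℂ)^3 + (γ:ℂ)^2 - 10*(γ:ℂ)/3 + 77/60)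
            * Complex.exp (3 * Complex.I * θ)
        + ((γ:ℂ)^4 - 2*(γ:ℂ)^3 + 2*(γ:ℂ)^2 - (γ:ℂ) + 1/5)
            * Complex.exp (4 * Complex.I * θ))
    (hb : ∀ θ : ℝ, b θ = ((γ:ℂ) + (1 - (γ:ℂ)) * Complex.exp (Complex.I * θ))^4)
    (hc : ∀ θ : ℝ, c θ = Complex.exp (-(Complex.I * θ)) *
        (((γ:ℂ) + (1 - (γ:ℂ)) * Complex.exp (Complex.I * θ))^4
          - (γ:ℂ)^4 * (1 - Complex.exp (Complex.I * θ))^5)) :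
    (∀ θ ∈ Set.Ico (0:ℝ) (2*π), a θ ≠ 0) ∧
    sSup ((fun θ : ℝ => ‖1 / a θ‖) '' Set.Ico (0:ℝ) (2*π)) = 1 ∧
    sSup ((fun θ : ℝ => ‖c θ / a θ‖) '' Set.Ico (0:ℝ) (2*π)) =
      15*(16*γ^4 + 32*γ^3 - 24*γ^2 + 8*γ - 1) / (16*(15*γ^4 - 15*γ^2 + 10*γ - 2)) ∧
    sInf ((fun θ : ℝ => (b θ / a θ).re) '' Set.Ico (0:ℝ) (2*π)) =
      15*(2*γ - 1)^4 / (16*(15*γ^4 - 15*γ^2 + 10*γ - 2)) ∧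
    sInf ((fun θ : ℝ => (b θ / a θ).re) '' Set.Ico (0:ℝ) (2*π)) /
        sSup ((fun θ : ℝ => ‖c θ / a θ‖) '' Set.Ico (0:ℝ) (2*π)) =
      (2*γ - 1)^4 / (16*γ^4 + 32*γ^3 - 24*γ^2 + 8*γ - 1) := by
  set D : ℝ := 16/15 * (15*γ^4 - 15*γ^2 + 10*γ - 2) with hD_def
  set N : ℝ := 16*γ^4 + 32*γ^3 - 24*γ^2 + 8*γ - 1 with hN_def
  have hD : 0 < D := by
    obtain ⟨g, hg, rfl⟩ := le_iff_exists_nonneg_add.1 hγ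
    rw [hD_def]
    ring_nf
    positivity
  have hN : 0 < N := by
    obtain ⟨g, hg, rfl⟩ := le_iff_exists_nonneg_add.1 hγ
    rw [hN_def]
    ring_nf
    positivity
  have hsin (θ : ℝ) : sin θ ^ 2 = 1 - cos θ ^ 2 := Real.sin_sq θ
  have hexp (θ : ℝ) : Complex.exp (Complex.I * θ) = (cos θ : ℝ) + (sin θ : ℝ) * Complex.I := by
    rw [mul_comm, Complex.exp_mul_I, Complex.ofReal_cos, Complex.ofReal_sin]
  have ha' (θ : ℝ) : a θ = ⟨siemsARe γ (cos θ), sin θ * siemsAIm γ (cos θ)⟩ := by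
    have e2 : Complex.exp (2 * Complex.I * θ) = Complex.exp (Complex.I * θ) ^ 2 := by
      rw [← Complex.exp_nat_mul]; congr 1; push_cast; ring
    have e3 : Complex.exp (3 * Complex.I * θ) = Complex.exp (Complex.I * θ) ^ 3 := by
      rw [← Complex.exp_nat_mul]; congr 1; push_cast; ring
    have e4 : Complex.exp (4 * Complex.I * θ) = Complex.exp (Complex.I * θ) ^ 4 := by
      rw [← Complex.exp_nat_mul]; congr 1; push_cast; ring
    rw [siemsARe, siemsAIm, ← quartic_eq _ _ _ _ _ _ _ (hsin θ), ha, e2, e3, e4, hexp]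
    push_cast
    ring
  have hb' (θ : ℝ) : b θ = ⟨siemsBRe γ (cos θ), sin θ * siemsBIm γ (cos θ)⟩ := by
    rw [siemsBRe, siemsBIm, ← quartic_eq _ _ _ _ _ _ _ (hsin θ), hb, ← hexp]
    push_cast
    ring
  have hc' (θ : ℝ) : c θ = ⟨siemsCRe γ (cos θ), sin θ * siemsCIm γ (cos θ)⟩ := by
    rw [siemsCRe, siemsCIm, ← quartic_eq _ _ _ _ _ _ _ (hsin θ), hc, Complex.exp_neg, ← hexp]
    have := Complex.exp_ne_zero (Complex.I * θ)
    push_cast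
    field_simp
    ring
  have na (θ : ℝ) : ‖a θ‖^2 = siemsANormSq γ (cos θ) := by
    rw [← Complex.normSq_eq_norm_sq, ha', Complex.normSq_mk, siemsANormSq]
    linear_combination siemsAIm γ (cos θ) ^ 2 * hsin θ
  have nc (θ : ℝ) : ‖c θ‖^2 = siemsCNormSq γ (cos θ) := by
    rw [← Complex.normSq_eq_norm_sq, hc', Complex.normSq_mk, siemsCNormSq]
    linear_combination siemsCIm γ (cos θ) ^ 2 * hsin θ
  have ha1 (θ : ℝ) : 1 ≤ ‖a θ‖ := by
    have := one_le_siemsANormSq hγ (neg_one_le_cos θ) (cos_le_one θ)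
    rw [← na] at this
    exact (one_le_sq_iff₀ (norm_nonneg _)).1 this
  have hapos (θ : ℝ) : 0 < ‖a θ‖ := one_pos.trans_le (ha1 θ)
  have hca (θ : ℝ) : ‖c θ / a θ‖ ≤ N / D := by
    rw [norm_div, div_le_div_iff₀ (hapos θ) hD]
    have := siemsCNormSq_mul_le hγ (neg_one_le_cos θ) (cos_le_one θ)
    rw [← na, ← nc, ← mul_pow, ← mul_pow] at this
    rw [mul_comm]
    exact le_of_sq_le_sq this (by positivity)
  have hba_eq (θ : ℝ) : (b θ / a θ).re = siemsBCross γ (cos θ) / ‖a θ‖^2 := by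
    rw [Complex.div_re, Complex.normSq_eq_norm_sq, ← add_div, ha', hb', siemsBCross]
    congr 1
    linear_combination siemsBIm γ (cos θ) * siemsAIm γ (cos θ) * hsin θ
  have hba (θ : ℝ) : (2*γ - 1)^4 / D ≤ (b θ / a θ).re := by
    have := siemsANormSq_mul_le hγ (neg_one_le_cos θ) (cos_le_one θ)
    rw [hba_eq, div_le_div_iff₀ hD (pow_pos (hapos θ) 2), na, mul_comm _ D]
    exact this
  have h0 : (0 : ℝ) ∈ Ico (0 : ℝ) (2*π) := ⟨le_rfl, two_pi_pos⟩
  have hπ : π ∈ Ico (0 : ℝ) (2*π) := ⟨pi_pos.le, by linarith [pi_pos]⟩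
  have a0 : a 0 = 1 := by
    rw [ha]
    simp only [Complex.ofReal_zero, mul_zero, Complex.exp_zero]
    ring
  have aπ : a π = (D : ℂ) := by
    rw [ha']
    apply Complex.ext
    · simp only [siemsARe, quarticRe, cos_pi, Complex.ofReal_re, hD_def]
      ring
    · simp
  have bπ : b π = ((2*γ - 1)^4 : ℝ) := by
    rw [hb']
    apply Complex.ext
    · simp only [siemsBRe, quarticRe, cos_pi, Complex.ofReal_re]
      ring
    · rw [Complex.ofReal_im, sin_pi, zero_mul]
  have cπ : c π = (N : ℂ) := by
    rw [hc']
    apply Complex.ext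
    · simp only [siemsCRe, quarticRe, cos_pi, Complex.ofReal_re, hN_def]
      ring
    · simp
  have hσF : sSup ((fun θ : ℝ => ‖1 / a θ‖) '' Ico (0:ℝ) (2*π)) = 1 := by
    refine IsGreatest.csSup_eq ⟨⟨0, h0, by simp [a0]⟩, ?_⟩
    rintro _ ⟨θ, -, rfl⟩
    simpa using inv_le_one_of_one_le₀ (ha1 θ)
  have hσE : sSup ((fun θ : ℝ => ‖c θ / a θ‖) '' Ico (0:ℝ) (2*π)) = N / D := by
    refine IsGreatest.csSup_eq ⟨⟨π, hπ, ?_⟩, ?_⟩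
    · simp [aπ, cπ, abs_of_pos hD, abs_of_pos hN]
    · rintro _ ⟨θ, -, rfl⟩
      exact hca θ
  have hlam : sInf ((fun θ : ℝ => (b θ / a θ).re) '' Ico (0:ℝ) (2*π)) = (2*γ - 1)^4 / D := by
    refine IsLeast.csInf_eq ⟨⟨π, hπ, ?_⟩, ?_⟩
    · simp only [aπ, bπ, ← Complex.ofReal_div, Complex.ofReal_re]
    · rintro _ ⟨θ, -, rfl⟩
      exact hba θ
  have hscale (t : ℝ) : t / D = 15 * t / (16 * (15*γ^4 - 15*γ^2 + 10*γ - 2)) := by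
    have hE : 15*γ^4 - 15*γ^2 + 10*γ - 2 ≠ 0 := by
      intro h
      rw [hD_def, h, mul_zero] at hD
      exact lt_irrefl _ hD
    rw [hD_def]
    field_simp
  refine ⟨fun θ _ => norm_pos_iff.1 (hapos θ), hσF, ?_, ?_, ?_⟩
  · rw [hσE, hscale]
  · rw [hlam, hscale]
  · rw [hσE, hlam, div_div_div_cancel_right₀ hD.ne']
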